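/- Let H be an m×2n matrix over 𝔽₂ of full row rank m (so |Row(H)| = 2^m), and let q be a real number with 0 < q < 2^{−m}. Let v, e₁ ∈ 𝔽₂^{2n}, and suppose e ∈ v + Row(H) attains the minimum generalized weight over the coset v + Row(H), and that gw(e₁) < gw(e). Then ∑_{u ∈ e₁ + Row(H)} q^{gw(u)} > ∑_{u ∈ v + Row(H)} q^{gw(u)}. -/

import Mathlib

open Matrix Finset

/-- Generalized weight of `(x|z)`: `w_H(x) + w_H(z) − w_H(x∧z)`. -/
def gw {n : ℕ} (x z : Fin n → ZMod 2) : ℕ :=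
  hammingNorm x + hammingNorm z - hammingNorm (x * z)

/-- Generalized weight of a full vector `e = (x|z) ∈ 𝔽₂^{2n}`. -/
def gwFull {n : ℕ} (e : Fin n ⊕ Fin n → ZMod 2) : ℕ :=
  gw (fun j => e (Sum.inl j)) (fun j => e (Sum.inr j))

/-- The coset `v + Row(H)` of the row space of `H`, as a finite set. -/
def cosetF {m n : ℕ} (H : Matrix (Fin m) (Fin n ⊕ Fin n) (ZMod 2))
    (v : Fin n ⊕ Fin n → ZMod 2) : Finset (Fin n ⊕ Fin n → ZMod 2) :=
  Finset.image (fun c : Fin m → ZMod 2 => v + Matrix.vecMul c H) Finset.univ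

/-- key inequality for Theorem 3: let `H` have full row rank `m`,
let `0 < q < 2^{-m}`, let `e` attain the minimal generalized weight on the coset
`v + Row(H)`, and suppose `gw(e₁) < gw(e)`.  Then
`∑_{u ∈ e₁ + Row(H)} q^{gw(u)} > ∑_{u ∈ v + Row(H)} q^{gw(u)}`. -/
theorem coset_weight_sum_lt {m n : ℕ}
    (H : Matrix (Fin m) (Fin n ⊕ Fin n) (ZMod 2))
    (hfull : LinearIndependent (ZMod 2) (fun i : Fin m => H i))
    (q : ℝ) (hq0 : 0 < q) (hq1 : q < ((2 : ℝ) ^ m)⁻¹)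
    (v e e₁ : Fin n ⊕ Fin n → ZMod 2)
    (he : e ∈ cosetF H v)
    (hmin : ∀ u ∈ cosetF H v, gwFull e ≤ gwFull u)
    (h1 : gwFull e₁ < gwFull e) :
    ∑ u ∈ cosetF H v, q ^ gwFull u < ∑ u ∈ cosetF H e₁, q ^ gwFull u := by
  have hq1' : q ≤ 1 := hq1.le.trans (inv_le_one_of_one_le₀ (one_le_pow₀ one_le_two))
  have hcard : ((cosetF H v).card : ℝ) ≤ 2 ^ m := by
    have h : (cosetF H v).card ≤ 2 ^ m := by
      refine Finset.card_image_le.trans (le_of_eq ?_)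
      simp [ZMod.card]
    exact_mod_cast h
  have hmul : (2 : ℝ) ^ m * q < 1 := by
    rwa [lt_inv_comm₀ hq0 (by positivity), ← one_div, lt_div_iff₀ hq0] at hq1
  have hmem : e₁ ∈ cosetF H e₁ :=
    Finset.mem_image.mpr ⟨0, Finset.mem_univ _, by simp⟩
  calc ∑ u ∈ cosetF H v, q ^ gwFull u
      ≤ ∑ _u ∈ cosetF H v, q ^ (gwFull e₁ + 1) :=
        Finset.sum_le_sum fun u hu =>
          pow_le_pow_of_le_one hq0.le hq1' (h1.trans_le (hmin u hu))
    _ = (cosetF H v).card * q ^ (gwFull e₁ + 1) := by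
        rw [Finset.sum_const, nsmul_eq_mul]
    _ ≤ 2 ^ m * q ^ (gwFull e₁ + 1) := by gcongr
    _ = 2 ^ m * q * q ^ gwFull e₁ := by ring
    _ < q ^ gwFull e₁ := mul_lt_of_lt_one_left (by positivity) hmul
    _ ≤ ∑ u ∈ cosetF H e₁, q ^ gwFull u :=
        Finset.single_le_sum (f := fun u => q ^ gwFull u) (fun u _ => by positivity) hmem
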